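/- Let G be a finite strongly connected directed multigraph. The minimal length of a multi-Eulerian tour of G equals U_G / M_G, where U_G = Σ_{v∈V} κ_v d_v is the number of unicycles of G and M_G = gcd{κ_v : v ∈ V}. -/

import Mathlib

open Finset

structure Multigraph (V E : Type) where
  tail : E → V
  head : E → V

namespace Multigraph

variable {V E : Type} [Fintype V] [Fintype E] [DecidableEq V] [DecidableEq E]

/-- Outdegree of a vertex. -/
def outdeg (G : Multigraph V E) (v : V) : ℕ :=
  (Finset.univ.filter (fun e => G.tail e = v)).card

/-- Indegree of a vertex. -/
def indeg (G : Multigraph V E) (v : V) : ℕ :=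
  (Finset.univ.filter (fun e => G.head e = v)).card

/-- Number of edges from `u` to `v`. -/
def edgeCount (G : Multigraph V E) (u v : V) : ℕ :=
  (Finset.univ.filter (fun e => G.tail e = u ∧ G.head e = v)).card

/-- Directed graph Laplacian: `Δ u v = d_v δ_{uv} − d_{vu}`. -/
def laplacian (G : Multigraph V E) : Matrix V V ℤ :=
  fun u v => (if u = v then (G.outdeg v : ℤ) else 0) - (G.edgeCount v u : ℤ)

def Adj (G : Multigraph V E) (u v : V) : Prop := ∃ e, G.tail e = u ∧ G.head e = v

/-- Strong connectivity: every vertex reaches every other by a directed path. -/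
def StronglyConnected (G : Multigraph V E) : Prop :=
  ∀ u v : V, Relation.ReflTransGen G.Adj u v

/-- A list of edges forms a walk: consecutive edges are incident. -/
def IsWalk (G : Multigraph V E) : List E → Prop
  | [] => True
  | [_] => True
  | e :: f :: rest => G.head e = G.tail f ∧ G.IsWalk (f :: rest)

/-- A nonempty walk that returns to its starting vertex. -/
def IsClosedWalk (G : Multigraph V E) (w : List E) : Prop :=
  w ≠ [] ∧ G.IsWalk w ∧ w.getLast?.map G.head = w.head?.map G.tail

/-- The walk starts at vertex `v`. -/
def StartsAt (G : Multigraph V E) (w : List E) (v : V) : Prop :=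
  w.head?.map G.tail = some v

/-- A π-Eulerian tour: closed walk using each edge `e` exactly `π (tail e)` times. -/
def IsPiEulerian (G : Multigraph V E) (π : V → ℕ) (w : List E) : Prop :=
  G.IsClosedWalk w ∧ ∀ e : E, w.count e = π (G.tail e)

/-- An Eulerian tour: closed walk using each edge exactly once. -/
def IsEulerian (G : Multigraph V E) (w : List E) : Prop :=
  G.IsClosedWalk w ∧ ∀ e : E, w.count e = 1

/-- A multi-Eulerian tour: closed walk using each edge at least once, and edges
with the same tail equally often. -/
def IsMultiEulerian (G : Multigraph V E) (w : List E) : Prop :=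
  G.IsClosedWalk w ∧ (∀ e : E, 1 ≤ w.count e) ∧
  ∀ e f : E, G.tail e = G.tail f → w.count e = w.count f

/-- A spanning tree oriented toward `w`: every vertex other than `w` has exactly one
outgoing edge, `w` has none, and every vertex reaches `w` inside the subgraph. -/
def IsTreeTo (G : Multigraph V E) (w : V) (T : Finset E) : Prop :=
  (∀ v, v ≠ w → (T.filter (fun e => G.tail e = v)).card = 1) ∧
  (∀ e ∈ T, G.tail e ≠ w) ∧
  ∀ v : V, Relation.ReflTransGen (fun a b => ∃ e ∈ T, G.tail e = a ∧ G.head e = b) v w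

/-- Number of spanning trees oriented toward `w`. -/
noncomputable def treeCount (G : Multigraph V E) (w : V) : ℕ :=
  Nat.card {T : Finset E // G.IsTreeTo w T}

end Multigraph

namespace Multigraph

variable {V E : Type} [Fintype V] [Fintype E] [DecidableEq V] [DecidableEq E]

omit [Fintype V] [DecidableEq E] in
theorem sum_tail_eq_mul_outdeg (G : Multigraph V E) (π : V → ℕ) (v : V) :
    ∑ e with G.tail e = v, π (G.tail e) = π v * G.outdeg v := by
  rw [Finset.sum_congr rfl fun e he => by rw [(Finset.mem_filter.1 he).2], Finset.sum_const,
    smul_eq_mul, mul_comm, outdeg]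

section Trees

/-- A functional spanning subgraph in which every vertex, including `w` itself, flows into `w`:
it has a unique cycle, and that cycle passes through `w`. -/
def IsUnicycleThrough (G : Multigraph V E) (w : V) (U : Finset E) : Prop :=
  (∀ v, (U.filter (fun e => G.tail e = v)).card = 1) ∧
  ∀ v : V, Relation.ReflTransGen (fun a b => ∃ e ∈ U, G.tail e = a ∧ G.head e = b) v w

omit [Fintype V] [Fintype E] [DecidableEq E] in
theorem IsUnicycleThrough.eq_of_tail_eq {G : Multigraph V E} {w : V} {U : Finset E}
    (h : G.IsUnicycleThrough w U) {e f : E} (he : e ∈ U) (hf : f ∈ U)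
    (hef : G.tail e = G.tail f) : e = f :=
  Finset.card_le_one.1 (h.1 (G.tail f)).le e (by simp [he, hef]) f (by simp [hf])

omit [Fintype V] [Fintype E] in
theorem IsTreeTo.insert {G : Multigraph V E} {T : Finset E} {e : E}
    (h : G.IsTreeTo (G.tail e) T) : G.IsUnicycleThrough (G.tail e) (insert e T) := by
  refine ⟨fun v => ?_, fun v => Relation.ReflTransGen.mono ?_ _ _ (h.2.2 v)⟩
  · by_cases hv : v = G.tail e
    · subst hv
      rw [Finset.filter_insert, if_pos rfl, Finset.filter_false_of_mem h.2.1]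
      rfl
    · rw [Finset.filter_insert, if_neg (Ne.symm hv), h.1 v hv]
  · rintro a b ⟨f, hf, hab⟩
    exact ⟨f, Finset.mem_insert_of_mem hf, hab⟩

omit [Fintype V] [Fintype E] in
theorem IsUnicycleThrough.erase {G : Multigraph V E} {U : Finset E} {e : E}
    (h : G.IsUnicycleThrough (G.tail e) U) (he : e ∈ U) :
    G.IsTreeTo (G.tail e) (U.erase e) := by
  refine ⟨fun v hv => ?_, fun f hf hfe => ?_, fun v => ?_⟩
  · rw [← h.1 v]
    congr 1
    ext f
    simp only [Finset.mem_filter, Finset.mem_erase]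
    constructor
    · rintro ⟨⟨-, hf⟩, hfv⟩
      exact ⟨hf, hfv⟩
    · rintro ⟨hf, hfv⟩
      refine ⟨⟨?_, hf⟩, hfv⟩
      rintro rfl
      exact hv hfv.symm
  · rw [Finset.mem_erase] at hf
    exact hf.1 (h.eq_of_tail_eq hf.2 he hfe)
  · refine (h.2 v).head_induction_on .refl ?_
    rintro a b ⟨f, hf, rfl, rfl⟩ - ih
    by_cases hfe : f = e
    · rw [hfe]
    · exact .head ⟨f, Finset.mem_erase.2 ⟨hfe, hf⟩, rfl, rfl⟩ ih

omit [Fintype V] in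
open Classical in
theorem treeCount_tail_eq (G : Multigraph V E) (e : E) :
    G.treeCount (G.tail e) =
      (univ.filter fun U => G.IsUnicycleThrough (G.tail e) U ∧ e ∈ U).card := by
  rw [treeCount, Nat.card_eq_fintype_card, Fintype.card_subtype]
  refine Finset.card_bij' (fun T _ => insert e T) (fun U _ => U.erase e) ?_ ?_ ?_ ?_
  · intro T hT
    simpa using (Finset.mem_filter.1 hT).2.insert
  · intro U hU
    obtain ⟨hU, he⟩ := (Finset.mem_filter.1 hU).2
    simpa using hU.erase he
  · intro T hT
    refine Finset.erase_insert fun he => ?_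
    exact (Finset.mem_filter.1 hT).2.2.1 e he rfl
  · intro U hU
    exact Finset.insert_erase (Finset.mem_filter.1 hU).2.2

omit [Fintype V] [Fintype E] [DecidableEq E] in
/-- A unicycle through `v` has exactly one edge into `v` that lies on its cycle. -/
theorem IsUnicycleThrough.existsUnique_head {G : Multigraph V E} {v : V} {U : Finset E}
    (h : G.IsUnicycleThrough v U) :
    ∃! e, G.head e = v ∧ G.IsUnicycleThrough (G.tail e) U ∧ e ∈ U := by
  have hex : ∀ x, ∃ e ∈ U, G.tail e = x := fun x => by
    obtain ⟨e, he⟩ := Finset.card_pos.1 (h.1 x ▸ Nat.one_pos)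
    exact ⟨e, (Finset.mem_filter.1 he).1, (Finset.mem_filter.1 he).2⟩
  choose f hfU hft using hex
  have hedge : ∀ e ∈ U, G.head e = G.head (f (G.tail e)) := fun e he => by
    rw [h.eq_of_tail_eq he (hfU _) (hft _).symm]
    rw [hft]
  obtain ⟨y, hvy, e, he, rfl, hev⟩ := Relation.TransGen.tail'_iff.1
    (Relation.TransGen.head' ⟨f v, hfU v, hft v, rfl⟩ (h.2 (G.head (f v))))
  refine ⟨e, ⟨hev, ⟨h.1, fun x => (h.2 x).trans hvy⟩, he⟩, ?_⟩
  have hiter : ∀ {x y}, Relation.ReflTransGen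
      (fun a b => ∃ e ∈ U, G.tail e = a ∧ G.head e = b) x y →
      ∃ n, (fun a => G.head (f a))^[n] x = y := by
    intro x y hxy
    induction hxy with
    | refl => exact ⟨0, rfl⟩
    | tail _ hbc ih =>
      obtain ⟨n, rfl⟩ := ih
      obtain ⟨e, he, htl, rfl⟩ := hbc
      exact ⟨n + 1, by rw [Function.iterate_succ_apply', hedge e he, htl]⟩
  have hper : ∀ e ∈ U, G.head e = v → G.IsUnicycleThrough (G.tail e) U →
      G.tail e ∈ Function.periodicPts (fun a => G.head (f a)) := by
    intro e he hev hU
    obtain ⟨n, hn⟩ := hiter (hU.2 v)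
    refine Function.mk_mem_periodicPts n.succ_pos ?_
    rw [Function.IsPeriodicPt, Function.IsFixedPt, Function.iterate_succ_apply, ← hedge e he,
      hev, hn]
  rintro e' ⟨hev', hU', he'⟩
  refine h.eq_of_tail_eq he' he ((Function.bijOn_periodicPts _).injOn
    (hper e' he' hev' hU') (hper e he hev ⟨h.1, fun x => (h.2 x).trans hvy⟩) ?_)
  rw [← hedge e he, ← hedge e' he', hev, hev']

omit [Fintype V] in
open Classical in
theorem sum_treeCount_eq_card (G : Multigraph V E) (v : V) (p : E → Prop)
    (hp : ∀ e U, p e → e ∈ U → G.IsUnicycleThrough (G.tail e) U → G.IsUnicycleThrough v U)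
    (hp' : ∀ U, G.IsUnicycleThrough v U →
      ∃! e, p e ∧ G.IsUnicycleThrough (G.tail e) U ∧ e ∈ U) :
    ∑ e with p e, G.treeCount (G.tail e) =
      (univ.filter fun U => G.IsUnicycleThrough v U).card := by
  simp_rw [treeCount_tail_eq, Finset.card_filter]
  rw [Finset.sum_comm]
  refine Finset.sum_congr rfl fun U _ => ?_
  rw [← Finset.card_filter, Finset.filter_filter]
  split_ifs with hU
  · obtain ⟨e, he, huniq⟩ := hp' U hU
    rw [Finset.card_eq_one]
    refine ⟨e, Finset.eq_singleton_iff_unique_mem.2 ⟨by simpa using he, fun f hf => ?_⟩⟩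
    exact huniq f (by simpa using hf)
  · rw [Finset.card_eq_zero, Finset.filter_eq_empty_iff]
    exact fun e _ he => hU (hp e U he.1 he.2.2 he.2.1)

omit [Fintype V] in
/-- The Markov chain tree theorem. -/
theorem sum_treeCount_tail (G : Multigraph V E) (v : V) :
    ∑ e with G.head e = v, G.treeCount (G.tail e) = G.treeCount v * G.outdeg v := by
  classical
  have h₁ := G.sum_treeCount_eq_card v (fun e => G.head e = v)
    (by
      rintro e U rfl he hU
      exact ⟨hU.1, fun x => (hU.2 x).tail ⟨e, he, rfl, rfl⟩⟩)
    (fun U hU => hU.existsUnique_head)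
  have h₂ := G.sum_treeCount_eq_card v (fun e => G.tail e = v)
    (by
      rintro e U rfl he hU
      exact hU)
    (by
      intro U hU
      obtain ⟨e, he⟩ := Finset.card_pos.1 (hU.1 v ▸ Nat.one_pos)
      obtain ⟨heU, rfl⟩ := Finset.mem_filter.1 he
      exact ⟨e, ⟨rfl, hU, heU⟩, fun f hf => hU.eq_of_tail_eq hf.2.2 heU hf.1⟩)
  rw [← sum_tail_eq_mul_outdeg]
  convert h₁.trans h₂.symm

omit [Fintype V] [DecidableEq E] in
theorem StronglyConnected.treeCount_pos {G : Multigraph V E} (hsc : G.StronglyConnected) (w : V) :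
    0 < G.treeCount w := by
  classical
  let R : ℕ → V → Prop := fun n => Nat.rec (fun v => v = w)
    (fun _ P v => ∃ e, G.tail e = v ∧ P (G.head e)) n
  have hR : ∀ v, ∃ n, R n v := fun v => by
    refine (hsc v w).head_induction_on ⟨0, rfl⟩ ?_
    rintro a b ⟨e, ha, rfl⟩ - ⟨n, hn⟩
    exact ⟨n + 1, e, ha, hn⟩
  obtain ⟨d, hd⟩ : ∃ d : V → ℕ, ∀ v, v ≠ w → ∃ e, G.tail e = v ∧ d (G.head e) < d v := by
    refine ⟨fun v => Nat.find (hR v), fun v hv => ?_⟩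
    have hs := Nat.find_spec (hR v)
    rcases hn : Nat.find (hR v) with _ | n
    · rw [hn] at hs
      exact absurd hs hv
    · rw [hn] at hs
      obtain ⟨e, he, hh⟩ := hs
      exact ⟨e, he, (Nat.lt_succ_of_le (Nat.find_min' _ hh)).trans_eq hn.symm⟩
  choose f hft hlt using hd
  have : Nonempty {T : Finset E // G.IsTreeTo w T} := by
    refine ⟨univ.filter (fun e => ∃ h : G.tail e ≠ w, f (G.tail e) h = e), fun v hv => ?_, ?_, ?_⟩
    · rw [Finset.card_eq_one]
      refine ⟨f v hv, ?_⟩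
      ext e
      simp only [Finset.mem_filter, Finset.mem_univ, true_and, Finset.mem_singleton]
      constructor
      · rintro ⟨⟨_, h⟩, rfl⟩
        exact h.symm
      · rintro rfl
        exact ⟨⟨(hft v hv).symm ▸ hv, by simp only [hft]⟩, hft v hv⟩
    · intro e he
      exact (Finset.mem_filter.1 he).2.1
    · intro v
      induction hn : d v using Nat.strong_induction_on generalizing v with
      | _ n ih =>
        subst hn
        by_cases hv : v = w
        · rw [hv]
        · refine .head ⟨f v hv, ?_, hft v hv, rfl⟩ (ih _ (hlt v hv) _ rfl)
          simp [hft v hv, hv]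
  exact Nat.card_pos

end Trees

section Balance

/-- The weights `π` on vertices, spread to the outgoing edges, form a circulation. -/
def IsBalanced (G : Multigraph V E) (π : V → ℕ) : Prop :=
  ∀ v, ∑ e with G.head e = v, π (G.tail e) = π v * G.outdeg v

omit [DecidableEq E] in
/-- Balanced weights on a strongly connected graph are unique up to scaling. -/
theorem IsBalanced.mul_eq_mul {G : Multigraph V E} (hsc : G.StronglyConnected)
    {π κ : V → ℕ} (hπ : G.IsBalanced π) (hκ : G.IsBalanced κ) (hpos : ∀ v, 0 < κ v) (u v : V) :
    π u * κ v = π v * κ u := by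
  obtain ⟨m, -, hm⟩ := Finset.exists_min_image univ (fun v => (π v : ℚ) / κ v) ⟨u, mem_univ u⟩
  have hle : ∀ x, π m * κ x ≤ π x * κ m := fun x => by
    have := hm x (mem_univ x)
    rw [div_le_div_iff₀ (by exact_mod_cast hpos m) (by exact_mod_cast hpos x)] at this
    exact_mod_cast this
  have hall : ∀ x, π m * κ x = π x * κ m := fun x => by
    refine (hsc x m).head_induction_on rfl ?_
    rintro a b ⟨e, rfl, rfl⟩ - hb
    have hsum : ∑ e' with G.head e' = G.head e, π m * κ (G.tail e') =
        ∑ e' with G.head e' = G.head e, π (G.tail e') * κ m := by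
      rw [← Finset.mul_sum, ← Finset.sum_mul, hπ, hκ, ← mul_assoc, hb]
      ring
    exact (Finset.sum_eq_sum_iff_of_le fun e' _ => hle (G.tail e')).1 hsum e (by simp)
  have hu := hall u
  have hv := hall v
  have hm := hpos m
  have : π u * κ v * κ m = π v * κ u * κ m := by
    calc π u * κ v * κ m = (π u * κ m) * κ v := by ring
      _ = π m * κ v * κ u := by rw [← hu]; ring
      _ = π v * κ u * κ m := by rw [hv]; ring
  exact Nat.eq_of_mul_eq_mul_right hm this

theorem isBalanced_treeCount_div_gcd (G : Multigraph V E) :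
    G.IsBalanced fun v => G.treeCount v / univ.gcd G.treeCount := by
  intro v
  have hdvd : ∀ x, univ.gcd G.treeCount ∣ G.treeCount x := fun x =>
    Finset.gcd_dvd (mem_univ x)
  beta_reduce
  rw [← Nat.sum_div fun _ _ => hdvd _, sum_treeCount_tail, Nat.mul_comm,
    Nat.mul_div_assoc _ (hdvd v), Nat.mul_comm]

theorem IsBalanced.treeCount_div_gcd_le {G : Multigraph V E} (hsc : G.StronglyConnected)
    {π : V → ℕ} (hπ : G.IsBalanced π) (hpos : ∀ v, 0 < π v) (v : V) :
    G.treeCount v / univ.gcd G.treeCount ≤ π v := by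
  have h : π v * univ.gcd G.treeCount = univ.gcd π * G.treeCount v := by
    have : univ.gcd (fun x => π v * G.treeCount x) = univ.gcd (fun x => G.treeCount v * π x) :=
      Finset.gcd_congr rfl fun x _ => by
        rw [hπ.mul_eq_mul hsc G.sum_treeCount_tail hsc.treeCount_pos, mul_comm]
    rw [Finset.gcd_mul_left, Finset.gcd_mul_left] at this
    simpa [mul_comm] using this
  refine Nat.div_le_of_le_mul ?_
  rw [mul_comm, h]
  refine Nat.le_mul_of_pos_left _ (Nat.pos_of_ne_zero fun h0 => ?_)
  exact (hpos v).ne' (Finset.gcd_eq_zero_iff.1 h0 v (mem_univ v))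

end Balance

section Walks

omit [Fintype V] [Fintype E] [DecidableEq V] [DecidableEq E] in
theorem isWalk_iff_isChain (G : Multigraph V E) (w : List E) :
    G.IsWalk w ↔ w.IsChain fun e f => G.head e = G.tail f := by
  induction w with
  | nil => simp [IsWalk]
  | cons e l ih =>
    cases l with
    | nil => simp [IsWalk]
    | cons f l => rw [IsWalk, ih, List.isChain_cons_cons]

omit [Fintype V] [Fintype E] [DecidableEq V] [DecidableEq E] in
theorem IsClosedWalk.append_comm {G : Multigraph V E} {l₁ l₂ : List E}
    (h : G.IsClosedWalk (l₁ ++ l₂)) : G.IsWalk (l₂ ++ l₁) := by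
  obtain ⟨-, hwalk, hlast⟩ := h
  rw [isWalk_iff_isChain, List.isChain_append] at *
  refine ⟨hwalk.2.1, hwalk.1, fun x hx y hy => ?_⟩
  rw [Option.mem_def] at hx hy
  simpa [List.getLast?_append, List.head?_append, hx, hy] using hlast

omit [Fintype V] [Fintype E] [DecidableEq E] in
/-- Arrivals and departures at `x` along a walk from `a` to `b`. -/
theorem IsWalk.countP_head_add {G : Multigraph V E} {w : List E} (hw : G.IsWalk w) {a b : V}
    (ha : w.head?.map G.tail = some a) (hb : w.getLast?.map G.head = some b) (x : V) :
    w.countP (fun e => G.head e = x) + (if a = x then 1 else 0) =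
      w.countP (fun e => G.tail e = x) + if b = x then 1 else 0 := by
  induction w generalizing a with
  | nil => simp at ha
  | cons e l ih =>
    obtain rfl : G.tail e = a := by simpa using ha
    cases l with
    | nil =>
      obtain rfl : G.head e = b := by simpa using hb
      simp [List.countP_cons, add_comm]
    | cons f l =>
      have := ih hw.2 (a := G.head e) (by simp [hw.1]) (by simpa using hb)
      rw [List.countP_cons, List.countP_cons (a := e)]
      simp only [decide_eq_true_eq]
      omega

omit [Fintype V] [DecidableEq V] in
theorem sum_count_eq_countP (w : List E) (p : E → Prop) [DecidablePred p] :
    ∑ e with p e, w.count e = w.countP (fun e => p e) := by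
  rw [← Finset.sum_filter_count_eq_countP]
  refine (Finset.sum_subset (Finset.filter_subset_filter _ (Finset.subset_univ _)) ?_).symm
  intro e he hew
  refine List.count_eq_zero_of_not_mem fun h => hew ?_
  simpa [h] using he

omit [Fintype V] [DecidableEq V] in
theorem sum_count_eq_length (w : List E) : ∑ e, w.count e = w.length := by
  simpa using sum_count_eq_countP w fun _ => True

omit [Fintype V] in
theorem IsClosedWalk.sum_count_head {G : Multigraph V E} {w : List E} (hw : G.IsClosedWalk w)
    (x : V) : ∑ e with G.head e = x, w.count e = ∑ e with G.tail e = x, w.count e := by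
  obtain ⟨e, l, rfl⟩ := List.exists_cons_of_ne_nil hw.1
  have := hw.2.1.countP_head_add (a := G.tail e) (b := G.tail e) rfl (by rw [hw.2.2]; rfl) x
  rw [sum_count_eq_countP, sum_count_eq_countP]
  omega

omit [Fintype V] in
/-- Euler's theorem for directed multigraphs with edge multiplicities `m`. -/
theorem StronglyConnected.exists_isClosedWalk_count_eq [Nonempty E] {G : Multigraph V E}
    (hsc : G.StronglyConnected) (m : E → ℕ) (hm : ∀ e, 0 < m e)
    (hbal : ∀ x, ∑ e with G.head e = x, m e = ∑ e with G.tail e = x, m e) :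
    ∃ w, G.IsClosedWalk w ∧ ∀ e, w.count e = m e := by
  let S : Set ℕ := {n | ∃ w, G.IsWalk w ∧ (∀ e, w.count e ≤ m e) ∧ w.length = n}
  have hbdd : BddAbove S := by
    refine ⟨∑ e, m e, ?_⟩
    rintro _ ⟨w, -, hc, rfl⟩
    rw [← sum_count_eq_length]
    exact Finset.sum_le_sum fun e _ => hc e
  obtain ⟨w, hw, hc, hlen⟩ : sSup S ∈ S :=
    Nat.sSup_mem ⟨0, [], trivial, fun _ => by simp, rfl⟩ hbdd
  have hmax : ∀ w', G.IsWalk w' → (∀ e, w'.count e ≤ m e) → w'.length ≤ w.length :=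
    fun w' hw' hc' => hlen ▸ le_csSup hbdd ⟨w', hw', hc', rfl⟩
  have hne : w ≠ [] := by
    rintro rfl
    obtain ⟨e⟩ := ‹Nonempty E›
    refine absurd (hmax [e] trivial fun f => ?_) (by simp)
    exact (List.count_le_length).trans (hm f)
  -- a longest walk cannot be prolonged, nor can any of its rearrangements
  have hsat : ∀ l e f, (l ++ [e]).Perm w → G.IsWalk (l ++ [e]) → G.tail f = G.head e →
      w.count f = m f := by
    intro l e f hperm hwalk hf
    by_contra hcf
    have hlt := lt_of_le_of_ne (hc f) hcf
    refine absurd (hmax (l ++ [e] ++ [f]) ?_ fun g => ?_) ?_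
    · rw [isWalk_iff_isChain] at hwalk ⊢
      rw [List.isChain_append]
      refine ⟨hwalk, by simp, ?_⟩
      simp [hf]
    · rw [List.count_append, hperm.count_eq, List.count_singleton]
      split_ifs with hfg
      · obtain rfl : f = g := by simpa using hfg
        exact hlt
      · exact hc g
    · simp [← hperm.length_eq]
  have hclosed : G.IsClosedWalk w := by
    refine ⟨hne, hw, ?_⟩
    obtain ⟨l, e, hl⟩ := (List.eq_nil_or_concat' w).resolve_left hne
    obtain ⟨a, t, ht⟩ := List.exists_cons_of_ne_nil hne
    have ha : w.head?.map G.tail = some (G.tail a) := by simp [ht]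
    have hb : w.getLast?.map G.head = some (G.head e) := by simp [hl]
    rw [ha, hb]
    by_contra hab
    have hcount := hw.countP_head_add ha hb (G.head e)
    rw [if_neg fun h => hab (by rw [h]), if_pos rfl, ← sum_count_eq_countP,
      ← sum_count_eq_countP] at hcount
    have h₁ : ∑ f with G.tail f = G.head e, w.count f = ∑ f with G.tail f = G.head e, m f :=
      Finset.sum_congr rfl fun f hf =>
        hsat l e f (by rw [hl]) (hl ▸ hw) (Finset.mem_filter.1 hf).2
    have h₂ : ∑ f with G.head f = G.head e, w.count f ≤ ∑ f with G.head f = G.head e, m f :=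
      Finset.sum_le_sum fun f _ => hc f
    rw [hbal] at h₂
    omega
  have hnext : ∀ e ∈ w, ∀ f, G.tail f = G.head e → w.count f = m f := by
    intro e he f hf
    obtain ⟨l₁, l₂, hl⟩ := List.append_of_mem he
    refine hsat (l₂ ++ l₁) e f ?_ ?_ hf
    · rw [hl, List.append_assoc, List.append_cons l₁ e l₂]
      exact List.perm_append_comm
    · rw [List.append_assoc]
      rw [hl, List.append_cons] at hclosed
      exact hclosed.append_comm
  refine ⟨w, hclosed, fun f => ?_⟩
  obtain ⟨e₀, he₀⟩ := List.exists_mem_of_ne_nil w hne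
  obtain ⟨e, he, hef⟩ : ∃ e ∈ w, G.head e = G.tail f := by
    generalize G.tail f = v
    induction hsc (G.head e₀) v with
    | refl => exact ⟨e₀, he₀, rfl⟩
    | tail _ hbc ih =>
      obtain ⟨e, he, heb⟩ := ih
      obtain ⟨g, rfl, rfl⟩ := hbc
      exact ⟨g, List.count_pos_iff.1 (hnext e he g heb.symm ▸ hm g), rfl⟩
  exact hnext e he f hef.symm

end Walks

theorem length_eq_sum_mul_outdeg (G : Multigraph V E) {π : V → ℕ} {w : List E}
    (hw : ∀ e, w.count e = π (G.tail e)) : w.length = ∑ v, π v * G.outdeg v := by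
  rw [← sum_count_eq_length, ← Finset.sum_fiberwise univ G.tail]
  refine Finset.sum_congr rfl fun v _ => ?_
  rw [← sum_tail_eq_mul_outdeg]
  exact Finset.sum_congr rfl fun e _ => hw e

omit [Fintype V] [Fintype E] [DecidableEq V] [DecidableEq E] in
theorem StronglyConnected.exists_tail_eq [Nonempty E] {G : Multigraph V E}
    (hsc : G.StronglyConnected) (v : V) : ∃ e, G.tail e = v := by
  obtain ⟨e⟩ := ‹Nonempty E›
  rcases (hsc v (G.tail e)).cases_head with h | ⟨_, ⟨f, hf, -⟩, -⟩
  · exact ⟨e, h.symm⟩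
  · exact ⟨f, hf⟩

end Multigraph

theorem stmt11 {V E : Type} [Fintype V] [Fintype E] [DecidableEq V] [DecidableEq E]
    [Nonempty E] (G : Multigraph V E) (hsc : G.StronglyConnected) :
    IsLeast {n : ℕ | ∃ w : List E, G.IsMultiEulerian w ∧ w.length = n}
      ((∑ v : V, G.treeCount v * G.outdeg v) / Finset.univ.gcd G.treeCount) := by
  have hdvd : ∀ v, univ.gcd G.treeCount ∣ G.treeCount v := fun v => Finset.gcd_dvd (mem_univ v)
  have hU : (∑ v : V, G.treeCount v * G.outdeg v) / univ.gcd G.treeCount =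
      ∑ v, G.treeCount v / univ.gcd G.treeCount * G.outdeg v := by
    rw [Nat.sum_div fun v _ => (hdvd v).mul_right _]
    exact Finset.sum_congr rfl fun v _ => Nat.mul_div_right_comm (hdvd v) _
  rw [hU]
  constructor
  · have hpos : ∀ e, 0 < G.treeCount (G.tail e) / univ.gcd G.treeCount := fun e =>
      Nat.div_pos (Nat.le_of_dvd (hsc.treeCount_pos _) (hdvd _))
        (Nat.pos_of_dvd_of_pos (hdvd (G.tail e)) (hsc.treeCount_pos _))
    obtain ⟨w, hw, hc⟩ := hsc.exists_isClosedWalk_count_eq _ hpos fun x =>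
      (G.isBalanced_treeCount_div_gcd x).trans
        (G.sum_tail_eq_mul_outdeg (fun v => G.treeCount v / univ.gcd G.treeCount) x).symm
    refine ⟨w, ⟨hw, fun e => hc e ▸ hpos e, fun e f hef => ?_⟩, ?_⟩
    · rw [hc, hc, hef]
    · exact G.length_eq_sum_mul_outdeg (π := fun v => G.treeCount v / univ.gcd G.treeCount) hc
  · rintro _ ⟨w, ⟨hw, hpos, hconst⟩, rfl⟩
    choose out hout using hsc.exists_tail_eq
    have hc : ∀ e, w.count e = w.count (out (G.tail e)) := fun e => hconst _ _ (hout _).symm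
    have hbal : G.IsBalanced fun v => w.count (out v) := fun v => by
      rw [← G.sum_tail_eq_mul_outdeg fun v => w.count (out v)]
      simpa only [← hc] using hw.sum_count_head v
    rw [G.length_eq_sum_mul_outdeg (π := fun v => w.count (out v)) hc]
    exact Finset.sum_le_sum fun v _ =>
      Nat.mul_le_mul_right _ (hbal.treeCount_div_gcd_le hsc (fun _ => hpos _) v)
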